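/- arXiv:1005.0134 — 2 statements merged into one kernel-verified Lean document; each statement's English description precedes it below -/
import Mathlib

section
/- Let N ≥ 3, k ≥ 1, v ∈ ℝ^k, and for r > 0 define u_r : ℝ^N → ℝ^k componentwise by u_r^i(x) = v_i for |x| ≤ r, u_r^i(x) = v_i(1 + r − |x|) for r ≤ |x| ≤ r+1, and u_r^i(x) = 0 for |x| ≥ r+1. Let α(N) denote the Lebesgue measure of the unit ball in ℝ^N, and let F : ℝ^k → ℝ be continuous with F(0) = 0. Then as r → ∞: (a) ‖u_r^i‖²_{L²} = α(N) r^N v_i² + o(r^N) for each i; (b) ‖∇u_r^i‖²_{L²} = o(r^N) for each i; (c) ∫_{ℝ^N} F(u_r) dx = α(N) r^N F(v) + o(r^N). -/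
open MeasureTheory Filter Topology Asymptotics

noncomputable section

/-- The radial cutoff function: equal to the constant `v ∈ ℝ^k` on the ball of radius `r`,
linearly interpolated to `0` on the annulus `r ≤ ‖x‖ ≤ r + 1`, and `0` for `‖x‖ ≥ r + 1`. -/
def cutoff (N k : ℕ) (v : EuclideanSpace ℝ (Fin k)) (r : ℝ)
    (x : EuclideanSpace ℝ (Fin N)) : EuclideanSpace ℝ (Fin k) :=
  if ‖x‖ ≤ r then v
  else if ‖x‖ ≤ r + 1 then (1 + r - ‖x‖) • v
  else 0

theorem cutoff_eq_smul (N k : ℕ) (v : EuclideanSpace ℝ (Fin k)) (r : ℝ)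
    (x : EuclideanSpace ℝ (Fin N)) :
    cutoff N k v r x = max 0 (min 1 (1 + r - ‖x‖)) • v := by
  unfold cutoff
  split_ifs with h₁ h₂
  · rw [min_eq_left (by linarith), max_eq_right zero_le_one, one_smul]
  · rw [min_eq_right (by linarith), max_eq_right (by linarith)]
  · rw [min_eq_right (by linarith), max_eq_left (by linarith), zero_smul]

theorem cutoff_of_norm_le {N k : ℕ} (v : EuclideanSpace ℝ (Fin k)) {r : ℝ}
    {x : EuclideanSpace ℝ (Fin N)} (h : ‖x‖ ≤ r) : cutoff N k v r x = v :=
  if_pos h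

theorem cutoff_of_lt_norm {N k : ℕ} (v : EuclideanSpace ℝ (Fin k)) {r : ℝ}
    {x : EuclideanSpace ℝ (Fin N)} (h : r + 1 < ‖x‖) : cutoff N k v r x = 0 := by
  rw [cutoff, if_neg (by linarith), if_neg (by linarith)]

theorem continuous_cutoff (N k : ℕ) (v : EuclideanSpace ℝ (Fin k)) (r : ℝ) :
    Continuous (cutoff N k v r) := by
  rw [funext (cutoff_eq_smul N k v r)]
  fun_prop

theorem lipschitzWith_cutoff_apply (N k : ℕ) (v : EuclideanSpace ℝ (Fin k)) (r : ℝ) (i : Fin k) :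
    LipschitzWith ‖v i‖₊ fun x => cutoff N k v r x i := by
  have h : LipschitzWith 1 fun x : EuclideanSpace ℝ (Fin N) => max 0 (min 1 (1 + r - ‖x‖)) := by
    refine LipschitzWith.const_max (LipschitzWith.const_min ?_ 1) 0
    refine LipschitzWith.of_dist_le_mul fun x y => ?_
    rw [Real.dist_eq, sub_sub_sub_cancel_left, dist_comm, dist_eq_norm, NNReal.coe_one, one_mul]
    exact abs_norm_sub_norm_le y x
  refine LipschitzWith.of_dist_le_mul fun x y => ?_
  have hxy := h.dist_le_mul x y
  rw [NNReal.coe_one, one_mul] at hxy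
  simp only [cutoff_eq_smul, PiLp.smul_apply, smul_eq_mul, Real.dist_eq, ← sub_mul, abs_mul,
    coe_nnnorm, Real.norm_eq_abs] at hxy ⊢
  rw [mul_comm]
  gcongr

theorem norm_gradient_cutoff_apply_le (N k : ℕ) (v : EuclideanSpace ℝ (Fin k)) (r : ℝ)
    (i : Fin k) (x : EuclideanSpace ℝ (Fin N)) :
    ‖gradient (fun y => cutoff N k v r y i) x‖ ≤ ‖v i‖ := by
  rw [gradient, LinearIsometryEquiv.norm_map]
  exact norm_fderiv_le_of_lipschitz ℝ (lipschitzWith_cutoff_apply N k v r i)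

theorem gradient_cutoff_apply_of_notMem {N k : ℕ} (v : EuclideanSpace ℝ (Fin k)) {r : ℝ}
    (i : Fin k) {x : EuclideanSpace ℝ (Fin N)}
    (hx : x ∉ Metric.closedBall 0 (r + 1) \ Metric.ball 0 r) :
    gradient (fun y => cutoff N k v r y i) x = 0 := by
  simp only [Set.mem_sdiff, mem_closedBall_zero_iff, mem_ball_zero_iff, not_and_or, not_le,
    not_not] at hx
  obtain ⟨c, hc⟩ : ∃ c : ℝ, (fun y => cutoff N k v r y i) =ᶠ[𝓝 x] fun _ => c := by
    rcases hx with hx | hx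
    · refine ⟨0, ?_⟩
      filter_upwards [continuous_norm.continuousAt.eventually (lt_mem_nhds hx)] with y hy
      simp [cutoff_of_lt_norm v hy]
    · refine ⟨v i, ?_⟩
      filter_upwards [continuous_norm.continuousAt.eventually (gt_mem_nhds hx)] with y hy
      rw [cutoff_of_norm_le v (le_of_lt hy)]
  rw [gradient, hc.fderiv_eq, fderiv_fun_const, Pi.zero_apply, map_zero]

theorem measureReal_euclideanBall (N : ℕ) {r : ℝ} (hr : 0 < r) :
    volume.real (Metric.ball (0 : EuclideanSpace ℝ (Fin N)) r) =
      r ^ N * volume.real (Metric.ball (0 : EuclideanSpace ℝ (Fin N)) 1) := by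
  rw [measureReal_def, Measure.addHaar_ball_of_pos _ _ hr, finrank_euclideanSpace_fin,
    ENNReal.toReal_mul, ENNReal.toReal_ofReal (by positivity), measureReal_def]

theorem measureReal_annulus (N : ℕ) {r : ℝ} (hr : 0 < r) :
    volume.real (Metric.closedBall (0 : EuclideanSpace ℝ (Fin N)) (r + 1) \ Metric.ball 0 r) =
      volume.real (Metric.ball (0 : EuclideanSpace ℝ (Fin N)) 1) * ((r + 1) ^ N - r ^ N) := by
  rw [measureReal_sdiff (Metric.ball_subset_closedBall.trans
      (Metric.closedBall_subset_closedBall (by linarith))) measurableSet_ball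
      measure_closedBall_lt_top.ne,
    Measure.addHaar_real_closedBall _ _ (by linarith), measureReal_euclideanBall N hr,
    finrank_euclideanSpace_fin]
  ring

theorem isLittleO_add_one_pow_sub_pow (N : ℕ) :
    (fun r : ℝ => (r + 1) ^ N - r ^ N) =o[atTop] fun r : ℝ => r ^ N := by
  have h : (fun r : ℝ => r + 1) ~[atTop] fun r => r := by
    refine (isLittleO_const_id_atTop (1 : ℝ)).congr_left fun r => ?_
    simp
  exact (h.pow N).isLittleO

/-- Integrals of uniformly bounded functions that vanish off the annulus `r ≤ ‖x‖ ≤ r + 1` grow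
more slowly than `r ^ N`. -/
theorem isLittleO_integral_of_eq_zero_off_annulus {N : ℕ} {C : ℝ}
    {h : ℝ → EuclideanSpace ℝ (Fin N) → ℝ} (hC : ∀ r x, ‖h r x‖ ≤ C)
    (h0 : ∀ r, ∀ x ∉ Metric.closedBall 0 (r + 1) \ Metric.ball 0 r, h r x = 0) :
    (fun r : ℝ => ∫ x, h r x) =o[atTop] fun r : ℝ => r ^ N := by
  refine IsBigO.trans_isLittleO (IsBigO.of_bound
    (C * volume.real (Metric.ball (0 : EuclideanSpace ℝ (Fin N)) 1)) ?_)
    (isLittleO_add_one_pow_sub_pow N)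
  filter_upwards [eventually_gt_atTop 0] with r hr
  rw [← setIntegral_eq_integral_of_forall_compl_eq_zero (h0 r)]
  refine (norm_setIntegral_le_of_norm_le_const
    ((measure_mono Set.sdiff_subset).trans_lt measure_closedBall_lt_top) fun x _ => hC r x).trans ?_
  rw [measureReal_annulus N hr, mul_assoc, Real.norm_of_nonneg]
  exact sub_nonneg.2 (pow_le_pow_left₀ hr.le (by linarith) N)

theorem exists_norm_comp_cutoff_le (N : ℕ) {k : ℕ} (v : EuclideanSpace ℝ (Fin k))
    {F : EuclideanSpace ℝ (Fin k) → ℝ} (hF : Continuous F) :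
    ∃ C, ∀ r x, ‖F (cutoff N k v r x)‖ ≤ C := by
  have hK : IsCompact ((fun t : ℝ => t • v) '' Set.Icc 0 1) :=
    isCompact_Icc.image (by fun_prop)
  obtain ⟨C, hC⟩ := hK.exists_bound_of_continuousOn hF.continuousOn
  refine ⟨C, fun r x => hC _ ⟨_, ⟨le_max_left _ _, ?_⟩, (cutoff_eq_smul N k v r x).symm⟩⟩
  exact max_le zero_le_one (min_le_left _ _)

theorem integrable_comp_cutoff (N : ℕ) {k : ℕ} (v : EuclideanSpace ℝ (Fin k))
    {F : EuclideanSpace ℝ (Fin k) → ℝ} (hF : Continuous F) (hF0 : F 0 = 0) (r : ℝ) :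
    Integrable fun x => F (cutoff N k v r x) := by
  refine (hF.comp (continuous_cutoff N k v r)).integrable_of_hasCompactSupport
    (HasCompactSupport.intro (isCompact_closedBall 0 (r + 1)) fun x hx => ?_)
  rw [mem_closedBall_zero_iff, not_le] at hx
  rw [Function.comp_apply, cutoff_of_lt_norm v hx, hF0]

theorem isLittleO_integral_comp_cutoff_sub (N : ℕ) {k : ℕ} (v : EuclideanSpace ℝ (Fin k))
    {F : EuclideanSpace ℝ (Fin k) → ℝ} (hF : Continuous F) (hF0 : F 0 = 0) :
    (fun r : ℝ => (∫ x, F (cutoff N k v r x)) -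
        (volume (Metric.ball (0 : EuclideanSpace ℝ (Fin N)) 1)).toReal * r ^ N * F v)
      =o[atTop] fun r : ℝ => r ^ N := by
  obtain ⟨C, hC⟩ := exists_norm_comp_cutoff_le N v hF
  have key : (fun r : ℝ => ∫ x, (F (cutoff N k v r x) -
      (Metric.ball (0 : EuclideanSpace ℝ (Fin N)) r).indicator (fun _ => F v) x))
      =o[atTop] fun r : ℝ => r ^ N := by
    refine isLittleO_integral_of_eq_zero_off_annulus (C := C + ‖F v‖) (fun r x => ?_)
      fun r x hx => ?_
    · exact (norm_sub_le _ _).trans (add_le_add (hC r x) (norm_indicator_le_norm_self _ _))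
    · by_cases hxr : x ∈ Metric.ball 0 r
      · rw [Set.indicator_of_mem hxr, cutoff_of_norm_le v (mem_ball_zero_iff.1 hxr).le, sub_self]
      · have hx' : r + 1 < ‖x‖ := by
          by_contra! hle
          exact hx ⟨mem_closedBall_zero_iff.2 hle, hxr⟩
        rw [Set.indicator_of_notMem hxr, cutoff_of_lt_norm v hx', hF0, sub_zero]
  refine key.congr' ?_ EventuallyEq.rfl
  filter_upwards [eventually_gt_atTop 0] with r hr
  rw [integral_sub (integrable_comp_cutoff N v hF hF0 r)
      ((integrable_indicator_iff measurableSet_ball).2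
        (integrableOn_const measure_ball_lt_top.ne)),
    integral_indicator measurableSet_ball, setIntegral_const,
    measureReal_euclideanBall N hr, smul_eq_mul, mul_comm (r ^ N), measureReal_def]

/-- With `α(N)` the Lebesgue measure of the unit ball of `ℝ^N` and
`F : ℝ^k → ℝ` continuous with `F(0) = 0`, as `r → ∞`:
(a) `‖u_r^i‖_{L²}² = α(N) r^N v_i² + o(r^N)`;
(b) `‖∇u_r^i‖_{L²}² = o(r^N)`;
(c) `∫ F(u_r) = α(N) r^N F(v) + o(r^N)`. -/
theorem stmt_13 (N k : ℕ) (hN : 3 ≤ N) (hk : 1 ≤ k)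
    (v : EuclideanSpace ℝ (Fin k))
    (F : EuclideanSpace ℝ (Fin k) → ℝ) (hF : Continuous F) (hF0 : F 0 = 0) :
    (∀ i : Fin k,
      (fun r : ℝ => (∫ x, (cutoff N k v r x i) ^ 2) -
          (volume (Metric.ball (0 : EuclideanSpace ℝ (Fin N)) 1)).toReal * r ^ N * (v i) ^ 2)
        =o[atTop] fun r : ℝ => r ^ N) ∧
    (∀ i : Fin k,
      (fun r : ℝ => ∫ x, ‖gradient (fun y => cutoff N k v r y i) x‖ ^ 2)
        =o[atTop] fun r : ℝ => r ^ N) ∧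
    ((fun r : ℝ => (∫ x, F (cutoff N k v r x)) -
          (volume (Metric.ball (0 : EuclideanSpace ℝ (Fin N)) 1)).toReal * r ^ N * F v)
        =o[atTop] fun r : ℝ => r ^ N) := by
  refine ⟨fun i => ?_, fun i => ?_, isLittleO_integral_comp_cutoff_sub N v hF hF0⟩
  · exact isLittleO_integral_comp_cutoff_sub N v (F := fun u => u i ^ 2) (by fun_prop) (by simp)
  · refine isLittleO_integral_of_eq_zero_off_annulus (C := ‖v i‖ ^ 2) (fun r x => ?_)
      fun r x hx => ?_
    · rw [norm_pow, norm_norm]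
      exact pow_le_pow_left₀ (norm_nonneg _) (norm_gradient_cutoff_apply_le N k v r i x) 2
    · rw [gradient_cutoff_apply_of_notMem v i hx, norm_zero, zero_pow two_ne_zero]
end
end

section
/- Let k ≥ 1 and let F : ℝ^k → ℝ be nonnegative of the form F(u) = (1/2)Σ_{i=1}^k m_i² u_i² + R(u) with m_i > 0. Suppose there exists v ∈ ℝ^k with v_i ≠ 0 for every i and F(v) = 0. Then hypothesis (H3) holds: there exists ω ∈ ℝ^k such that 2F(v) + Σ_{i=1}^k ω_i² v_i² − m_h ω_h v_h² < 0 for every h ∈ {1, …, k}. -/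
noncomputable section

/-- If `F(u) = (1/2) Σ_i m_i² u_i² + R(u)` is nonnegative with `m_i > 0`
and there exists `v` with nonzero coordinates and `F(v) = 0`, then hypothesis (H3) holds:
there exists `ω ∈ ℝ^k` such that
`2 F(v) + Σ_i ω_i² v_i² - m_h ω_h v_h² < 0` for every `h`. -/
theorem stmt_19 (k : ℕ) (hk : 1 ≤ k)
    (F R : EuclideanSpace ℝ (Fin k) → ℝ) (m : Fin k → ℝ) (hm : ∀ i, 0 < m i)
    (hFnonneg : ∀ u, 0 ≤ F u)
    (hFdef : ∀ u : EuclideanSpace ℝ (Fin k),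
      F u = (1 / 2) * ∑ i, (m i) ^ 2 * (u i) ^ 2 + R u)
    (v : EuclideanSpace ℝ (Fin k)) (hv : ∀ i, v i ≠ 0) (hFv : F v = 0) :
    ∃ ω : Fin k → ℝ, ∀ h,
      2 * F v + (∑ i, (ω i) ^ 2 * (v i) ^ 2) - m h * ω h * (v h) ^ 2 < 0 := by
  have hpos : ∀ i, 0 < m i * (v i) ^ 2 := fun i => mul_pos (hm i) (sq_pos_iff.2 (hv i))
  set C : ℝ := ∑ i, ((m i * (v i) ^ 2)⁻¹) ^ 2 * (v i) ^ 2 with hC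
  have hC0 : 0 ≤ C := Finset.sum_nonneg fun i _ => by positivity
  refine ⟨fun i => (C + 1)⁻¹ * (m i * (v i) ^ 2)⁻¹, fun h => ?_⟩
  have hsum : ∑ i, ((C + 1)⁻¹ * (m i * (v i) ^ 2)⁻¹) ^ 2 * (v i) ^ 2 = ((C + 1)⁻¹) ^ 2 * C := by
    simp only [hC, Finset.mul_sum, mul_pow, mul_assoc]
  have hlin : m h * ((C + 1)⁻¹ * (m h * (v h) ^ 2)⁻¹) * (v h) ^ 2 = (C + 1)⁻¹ := by
    have := (hpos h).ne'
    calc _ = (C + 1)⁻¹ * ((m h * (v h) ^ 2) * (m h * (v h) ^ 2)⁻¹) := by ring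
      _ = _ := by rw [mul_inv_cancel₀ this, mul_one]
  have hs : 0 < (C + 1)⁻¹ := by positivity
  have hsC : (C + 1)⁻¹ * (C + 1) = 1 := inv_mul_cancel₀ (by positivity)
  rw [hFv, hsum, hlin]
  nlinarith [mul_pos hs hs]
end
end
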